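/- arXiv:1709.04041 — 4 statements merged into one kernel-verified Lean document; each statement's English description precedes it below -/
import Mathlib

section
/- Let 𝔾 be a finite set of bonds and σ ∈ 𝔾, ξ ∈ 𝔨. If U : K^𝔾 → ℂ is continuously differentiable and discrete gauge invariant, then for every ω ∈ K^𝔾 and every discrete gauge transformation u : V(𝔾) → K one has (∇_ξ^σ U)(ω^u) = (∇_{Ad_{u(σ_i)}ξ}^σ U)(ω). In particular, if u(σ_i) = I then (∇_ξ^σ U)(ω^u) = (∇_ξ^σ U)(ω) for all ω ∈ K^𝔾. -/
/-!
Statement 0 (Lemma 2.17 of the paper).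

`K` is a compact Lie group realized as a closed matrix subgroup of the `D × D` complex
matrices, `𝔾` is a finite set of bonds with initial/final vertex maps into a vertex set `V`,
and `U : K^𝔾 → ℂ` is a `C¹` discrete gauge invariant function.  Then for every configuration
`ω`, every discrete gauge transformation `u : V → K`, every bond `σ` and every `ξ ∈ 𝔨`,
`(∇_ξ^σ U)(ω^u) = (∇_{Ad_{u(σ_i)} ξ}^σ U)(ω)`; in particular if `u(σ_i) = I` then
`(∇_ξ^σ U)(ω^u) = (∇_ξ^σ U)(ω)`.
-/

open Matrix

attribute [local instance] Matrix.linftyOpNormedAddCommGroup Matrix.linftyOpNormedRing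
  Matrix.linftyOpNormedAlgebra

noncomputable section

/-- `D × D` complex matrices. -/
abbrev Mat (D : ℕ) := Matrix (Fin D) (Fin D) ℂ

/-- The matrix of an element of a matrix subgroup `K` of `GL(D, ℂ)`. -/
def Kval {D : ℕ} (K : Subgroup (Mat D)ˣ) (k : K) : Mat D := ((k : (Mat D)ˣ) : Mat D)

/-- The action `ω ↦ ω^u` of a discrete gauge transformation `u : V(𝔾) → K` on a
configuration `ω : 𝔾 → K ⊆ ℂ^{D×D}`, `ω^u(σ) = u(σ_f)⁻¹ ω(σ) u(σ_i)`. -/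
def gaugeAct {D : ℕ} {G V : Type*} (K : Subgroup (Mat D)ˣ) (ini fin : G → V)
    (u : V → K) (ω : G → Mat D) : G → Mat D :=
  fun b => Kval K ((u (fin b))⁻¹) * ω b * Kval K (u (ini b))

/-- The directional derivative `(∇_ξ^σ U)(ω) = d/dt|₀ U(ω(·) e^{t δ_{σ,·} ξ})`. -/
def dirDeriv {D : ℕ} {G : Type*} [DecidableEq G] (σ : G) (ξ : Mat D)
    (U : (G → Mat D) → ℂ) (ω : G → Mat D) : ℂ :=
  deriv (fun t : ℝ => U (Function.update ω σ (ω σ * NormedSpace.exp (t • ξ)))) 0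

/-- Invariance under the gauge action turns the two curves into each other. -/
theorem gaugeAct_update_exp {D : ℕ} {G V : Type*} [DecidableEq G]
    (ini fin : G → V) (K : Subgroup (Mat D)ˣ) (σ : G) (ξ : Mat D) (ω : G → Mat D)
    (u : V → K) (t : ℝ) :
    Function.update (gaugeAct K ini fin u ω) σ
        (gaugeAct K ini fin u ω σ * NormedSpace.exp (t • ξ))
      = gaugeAct K ini fin u (Function.update ω σ
        (ω σ * NormedSpace.exp
          (t • (Kval K (u (ini σ)) * ξ * Kval K ((u (ini σ))⁻¹))))) := by
  have hexp : NormedSpace.exp (t • (Kval K (u (ini σ)) * ξ * Kval K ((u (ini σ))⁻¹)))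
      = Kval K (u (ini σ)) * NormedSpace.exp (t • ξ) * Kval K ((u (ini σ))⁻¹) := by
    have h := Matrix.exp_units_conj ((u (ini σ) : (Mat D)ˣ)) (t • ξ)
    simpa [Kval] using h
  have hk : Kval K ((u (ini σ))⁻¹) * Kval K (u (ini σ)) = 1 := by
    simp only [Kval, ← Units.val_mul, ← Subgroup.coe_mul, inv_mul_cancel,
      Subgroup.coe_one, Units.val_one]
  funext b
  by_cases hb : b = σ
  · subst hb
    simp only [gaugeAct, Function.update_self, hexp]
    simp only [mul_assoc, hk, mul_one]
  · simp only [gaugeAct, Function.update_of_ne hb]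

theorem stmt0 {D : ℕ} {G V : Type*} [Fintype G] [DecidableEq G]
    (ini fin : G → V) (K : Subgroup (Mat D)ˣ) (𝔨 : Set (Mat D))
    (U : (G → Mat D) → ℂ) (hU : ContDiff ℝ 1 U)
    (hinv : ∀ (ω : G → Mat D) (u : V → K), U (gaugeAct K ini fin u ω) = U ω)
    (σ : G) (ξ : Mat D) (hξ : ξ ∈ 𝔨) (ω : G → Mat D) (u : V → K) :
    dirDeriv σ ξ U (gaugeAct K ini fin u ω)
      = dirDeriv σ (Kval K (u (ini σ)) * ξ * Kval K ((u (ini σ))⁻¹)) U ω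
    ∧ (u (ini σ) = 1 →
        dirDeriv σ ξ U (gaugeAct K ini fin u ω) = dirDeriv σ ξ U ω) := by
  have main : dirDeriv σ ξ U (gaugeAct K ini fin u ω)
      = dirDeriv σ (Kval K (u (ini σ)) * ξ * Kval K ((u (ini σ))⁻¹)) U ω := by
    simp only [dirDeriv, gaugeAct_update_exp, hinv]
  refine ⟨main, fun h => ?_⟩
  rw [main, h]
  simp [Kval]

end
end

section
/- Let b, c be two bonds in 𝔾 with common initial vertex b_i = c_i = q. If U : K^𝔾 → ℂ is twice continuously differentiable and discrete gauge invariant, then for any orthonormal basis β of 𝔨 the function ∇^b·∇^c U := Σ_{ξ∈β} ∇_ξ^b ∇_ξ^c U is again discrete gauge invariant, i.e. (∇^b·∇^c U)(ω^u) = (∇^b·∇^c U)(ω) for all ω ∈ K^𝔾 and all u : V(𝔾) → K. -/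
/-!
Statement 1 (Proposition 2.19 of the paper).

If `b, c` are two bonds of `𝔾` with common initial vertex `q` and `U : K^𝔾 → ℂ` is a `C²`
discrete gauge invariant function, then for any orthonormal basis `β` of `𝔨` the function
`∇^b · ∇^c U = ∑_{ξ ∈ β} ∇_ξ^b ∇_ξ^c U` is again discrete gauge invariant.

Here `K` is a compact matrix subgroup of `GL(D, ℂ)`, `𝔨 ⊆ ℂ^{D×D}` is its Lie algebra with an
`Ad_K`-invariant inner product; the Lie algebra is modeled by a real inner product space `𝔨`
together with an injective linear embedding `ι : 𝔨 → ℂ^{D×D}` such that each `Ad_k`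
(`k ∈ K`) acts on `𝔨` as a linear isometry (this encodes the `Ad_K`-invariance of the inner
product).
-/

open Matrix

attribute [local instance] Matrix.linftyOpNormedAddCommGroup Matrix.linftyOpNormedRing
  Matrix.linftyOpNormedAlgebra

noncomputable section

section Abstract

variable {A : Type*} [NormedRing A] [NormedAlgebra ℝ A] [CompleteSpace A]
  {G : Type*} [Fintype G] [DecidableEq G]

lemma curve_hasDerivAt (σ : G) (ξ : A) (ω : G → A) :
    HasDerivAt (fun t : ℝ => Function.update ω σ (ω σ * NormedSpace.exp (t • ξ)))
      (Pi.single σ (ω σ * ξ)) 0 := by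
  have h1 : HasDerivAt (fun t : ℝ => NormedSpace.exp (t • ξ)) ξ 0 := by
    simpa using hasDerivAt_exp_smul_const (𝕂 := ℝ) ξ (0 : ℝ)
  have h2 : HasDerivAt (fun t : ℝ => ω σ * NormedSpace.exp (t • ξ)) (ω σ * ξ) 0 :=
    h1.const_mul (ω σ)
  refine hasDerivAt_pi.2 fun i => ?_
  by_cases hi : i = σ
  · subst hi
    simpa using h2
  · simpa [hi] using hasDerivAt_const (0 : ℝ) (ω i)

/-- The directional derivative expressed through the Fréchet derivative. -/
lemma abs_deriv (σ : G) (ξ : A) (F : (G → A) → ℂ) (ω : G → A) (hF : DifferentiableAt ℝ F ω) :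
    deriv (fun t : ℝ => F (Function.update ω σ (ω σ * NormedSpace.exp (t • ξ)))) 0
      = fderiv ℝ F ω (Pi.single σ (ω σ * ξ)) := by
  have h0 : Function.update ω σ (ω σ * NormedSpace.exp ((0 : ℝ) • ξ)) = ω := by
    simp
  have h4 : HasFDerivAt F (fderiv ℝ F ω)
      (Function.update ω σ (ω σ * NormedSpace.exp ((0 : ℝ) • ξ))) := by
    rw [h0]; exact hF.hasFDerivAt
  exact (h4.comp_hasDerivAt (0 : ℝ) (curve_hasDerivAt σ ξ ω)).deriv

/-- The linear map `ξ ↦ ω σ * ξ` supported at `σ`. -/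
def sLin (σ : G) (ω : G → A) : A →ₗ[ℝ] (G → A) :=
  (LinearMap.single ℝ (fun _ : G => A) σ).comp (LinearMap.mulLeft ℝ (ω σ))

lemma sLin_apply (σ : G) (ω : G → A) (ξ : A) : sLin σ ω ξ = Pi.single σ (ω σ * ξ) := rfl

/-- The continuous linear map `ω ↦ ω σ * ξ` supported at `σ`. -/
def rLin (σ : G) (ξ : A) : (G → A) →L[ℝ] (G → A) :=
  (ContinuousLinearMap.single ℝ (fun _ : G => A) σ).comp
    (((ContinuousLinearMap.mul ℝ A).flip ξ).comp (ContinuousLinearMap.proj σ))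

lemma rLin_apply (σ : G) (ω : G → A) (ξ : A) : rLin σ ξ ω = Pi.single σ (ω σ * ξ) := rfl

lemma abs_deriv_deriv (b c : G) (η ξ : A) (U : (G → A) → ℂ) (hU : ContDiff ℝ 2 U)
    (ω : G → A) :
    deriv (fun s : ℝ => (fun ω : G → A =>
      deriv (fun t : ℝ => U (Function.update ω c (ω c * NormedSpace.exp (t • ξ)))) 0)
        (Function.update ω b (ω b * NormedSpace.exp (s • η)))) 0 =
      fderiv ℝ (fderiv ℝ U) ω (sLin b ω η) (sLin c ω ξ)
        + fderiv ℝ U ω (sLin c (sLin b ω η) ξ) := by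
  have hd : Differentiable ℝ U := hU.differentiable (by norm_num)
  have hd2 : Differentiable ℝ (fderiv ℝ U) :=
    (hU.fderiv_right (m := 1) (by norm_num)).differentiable (by norm_num)
  have e : (fun ω : G → A =>
      deriv (fun t : ℝ => U (Function.update ω c (ω c * NormedSpace.exp (t • ξ)))) 0)
        = fun ω => fderiv ℝ U ω (rLin c ξ ω) := by
    funext ω
    rw [abs_deriv c ξ U ω (hd ω), rLin_apply]
  have h := (hd2 ω).hasFDerivAt.clm_apply (rLin c ξ).hasFDerivAt (x := ω)
  rw [e, abs_deriv b η _ ω h.differentiableAt, h.fderiv]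
  simp only [_root_.add_apply, ContinuousLinearMap.comp_apply,
    ContinuousLinearMap.flip_apply, rLin_apply, sLin_apply]
  rw [add_comm]

/-- The second directional derivative is bilinear in the two directions. -/
lemma abs_bilin (b c : G) (U : (G → A) → ℂ) (hU : ContDiff ℝ 2 U) (ω : G → A) :
    ∃ B : A →ₗ[ℝ] A →ₗ[ℝ] ℂ, ∀ η ξ : A,
    deriv (fun s : ℝ => (fun ω : G → A =>
      deriv (fun t : ℝ => U (Function.update ω c (ω c * NormedSpace.exp (t • ξ)))) 0)
        (Function.update ω b (ω b * NormedSpace.exp (s • η)))) 0 = B η ξ := by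
  refine ⟨LinearMap.mk₂ ℝ
    (fun x y => fderiv ℝ (fderiv ℝ U) ω (sLin b ω x) (sLin c ω y)
        + fderiv ℝ U ω (sLin c (sLin b ω x) y)) ?_ ?_ ?_ ?_, fun η ξ =>
          abs_deriv_deriv b c η ξ U hU ω⟩
  · intro x y z
    have : sLin c (sLin b ω x + sLin b ω y) z =
        sLin c (sLin b ω x) z + sLin c (sLin b ω y) z := by
      simp only [sLin_apply c, Pi.add_apply, add_mul, Pi.single_add]
    simp only [map_add, this, _root_.add_apply]
    abel
  · intro r x z
    have : sLin c (r • sLin b ω x) z = r • sLin c (sLin b ω x) z := by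
      simp only [sLin_apply c, Pi.smul_apply, smul_mul_assoc, Pi.single_smul]
    simp only [map_smul, this, _root_.smul_apply, smul_add]
  · intro x y z
    simp only [map_add]
    abel
  · intro r x z
    simp only [map_smul, smul_add]

end Abstract

lemma Kval_mul_inv {D : ℕ} (K : Subgroup (Mat D)ˣ) (k : K) : Kval K k * Kval K k⁻¹ = 1 := by
  simp [Kval]

lemma Kval_inv_mul {D : ℕ} (K : Subgroup (Mat D)ˣ) (k : K) : Kval K k⁻¹ * Kval K k = 1 := by
  simp [Kval]

lemma dirDeriv_gauge {D : ℕ} {G V : Type*} [DecidableEq G] (ini fin : G → V)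
    (K : Subgroup (Mat D)ˣ) (u : V → K) (σ : G) (ξ : Mat D)
    (F : (G → Mat D) → ℂ) (ω : G → Mat D) :
    dirDeriv σ ξ F (gaugeAct K ini fin u ω) =
      dirDeriv σ (Kval K (u (ini σ)) * ξ * Kval K (u (ini σ))⁻¹)
        (fun ω => F (gaugeAct K ini fin u ω)) ω := by
  unfold dirDeriv
  congr 1
  funext t
  congr 1
  have he : NormedSpace.exp (t • (Kval K (u (ini σ)) * ξ * Kval K (u (ini σ))⁻¹))
      = Kval K (u (ini σ)) * NormedSpace.exp (t • ξ) * Kval K (u (ini σ))⁻¹ := by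
    have := Matrix.exp_units_conj ((u (ini σ) : K) : (Mat D)ˣ) (t • ξ)
    simpa [Kval] using this
  funext i
  by_cases hi : i = σ
  · subst hi
    simp only [gaugeAct, Function.update_self, he]
    simp only [mul_assoc, Kval_inv_mul, mul_one]
  · simp [gaugeAct, hi]

lemma sum_basis_indep {n : ℕ} {𝔨 : Type*} [NormedAddCommGroup 𝔨] [InnerProductSpace ℝ 𝔨]
    (β γ : OrthonormalBasis (Fin n) ℝ 𝔨) (B : 𝔨 →ₗ[ℝ] 𝔨 →ₗ[ℝ] ℂ) :
    ∑ i, B (γ i) (γ i) = ∑ i, B (β i) (β i) := by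
  have h1 : ∀ i, B (γ i) (γ i) =
      ∑ j, ∑ k, (inner ℝ (β j) (γ i) * inner ℝ (γ i) (β k)) • B (β j) (β k) := by
    intro i
    conv_lhs => rw [← β.sum_repr' (γ i)]
    simp only [map_sum, LinearMap.sum_apply, map_smul, LinearMap.smul_apply, Finset.smul_sum,
      smul_smul]
    rw [Finset.sum_comm]
    refine Finset.sum_congr rfl fun j _ => Finset.sum_congr rfl fun k _ => ?_
    rw [real_inner_comm (β k) (γ i), mul_comm]
  simp only [h1]
  rw [Finset.sum_comm]
  refine Finset.sum_congr rfl fun j _ => ?_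
  rw [Finset.sum_comm]
  simp only [← Finset.sum_smul, γ.sum_inner_mul_inner]
  simp [orthonormal_iff_ite.mp β.orthonormal]

theorem stmt1 {D n : ℕ} {G V : Type*} [Fintype G] [DecidableEq G]
    (ini fin : G → V) (K : Subgroup (Mat D)ˣ)
    (𝔨 : Type*) [NormedAddCommGroup 𝔨] [InnerProductSpace ℝ 𝔨]
    (ι : 𝔨 →ₗ[ℝ] Mat D) (hι : Function.Injective ι)
    (hAd : ∀ k : K, ∃ T : 𝔨 ≃ₗᵢ[ℝ] 𝔨,
      ∀ x : 𝔨, ι (T x) = Kval K k * ι x * Kval K (k⁻¹))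
    (U : (G → Mat D) → ℂ) (hU : ContDiff ℝ 2 U)
    (hinv : ∀ (ω : G → Mat D) (u : V → K), U (gaugeAct K ini fin u ω) = U ω)
    (b c : G) (q : V) (hb : ini b = q) (hc : ini c = q)
    (β : OrthonormalBasis (Fin n) ℝ 𝔨)
    (ω : G → Mat D) (u : V → K) :
    ∑ i, dirDeriv b (ι (β i)) (dirDeriv c (ι (β i)) U) (gaugeAct K ini fin u ω)
      = ∑ i, dirDeriv b (ι (β i)) (dirDeriv c (ι (β i)) U) ω := by
  obtain ⟨T, hT⟩ := hAd (u q)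
  have hUg : (fun ω => U (gaugeAct K ini fin u ω)) = U := funext fun ω => hinv ω u
  have key : ∀ x : 𝔨, dirDeriv b (ι x) (dirDeriv c (ι x) U) (gaugeAct K ini fin u ω)
      = dirDeriv b (ι (T x)) (dirDeriv c (ι (T x)) U) ω := by
    intro x
    rw [dirDeriv_gauge]
    simp only [dirDeriv_gauge ini fin K u c]
    rw [hUg, hb, hc, ← hT]
  simp only [key]
  obtain ⟨B₀, hB₀⟩ : ∃ B : Mat D →ₗ[ℝ] Mat D →ₗ[ℝ] ℂ, ∀ η ξ : Mat D,
      dirDeriv b η (dirDeriv c ξ U) ω = B η ξ := abs_bilin b c U hU ω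
  let B : 𝔨 →ₗ[ℝ] 𝔨 →ₗ[ℝ] ℂ := B₀.compl₁₂ ι ι
  have hB : ∀ x : 𝔨, dirDeriv b (ι x) (dirDeriv c (ι x) U) ω = B x x := fun x =>
    hB₀ (ι x) (ι x)
  simp only [hB]
  simpa using sum_basis_indep β (β.map T) B

end
end

section
/- Let β : [0,1] → 𝔨 be C¹ with β(0) = 0, let g : [0,1] → K be the solution of g'(t) = −β'(t) g(t) with g(0) = I, and let ψ : ℂ^{D×D} → ℂ be twice continuously differentiable on a neighborhood of K. Then ψ(g(1)) = ψ(I) − (∇̂_{β(1)}ψ)(I) + ∫₀¹ ∫₀^τ (∇̂_{β'(s)} ∇̂_{β'(τ)} ψ)(g(s)) ds dτ, where (∇̂_ξ ψ)(k) := (d/dt)|_{t=0} ψ(e^{tξ} k). -/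
/-!
Statement 5 (the second-order Duhamel/Taylor expansion underlying Theorem 3.16).

Let `β : [0,1] → 𝔨` be `C¹` with `β(0) = 0`, let `g : [0,1] → K` solve `g' = −β' g`,
`g(0) = I`, and let `ψ : ℂ^{D×D} → ℂ` be `C²` on a neighborhood of `K`.  Then
`ψ(g(1)) = ψ(I) − (∇̂_{β(1)}ψ)(I) + ∫₀¹∫₀^τ (∇̂_{β'(s)}∇̂_{β'(τ)}ψ)(g(s)) ds dτ`,
where `(∇̂_ξψ)(k) := d/dt|₀ ψ(e^{tξ} k)`.
-/

open Matrix

attribute [local instance] Matrix.linftyOpNormedAddCommGroup Matrix.linftyOpNormedRing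
  Matrix.linftyOpNormedAlgebra

noncomputable section

/-- The right directional derivative `(∇̂_ξ ψ)(k) := d/dt|₀ ψ(e^{tξ} k)`. -/
def rightD {D : ℕ} (ξ : Mat D) (ψ : Mat D → ℂ) (k : Mat D) : ℂ :=
  deriv (fun t : ℝ => ψ (NormedSpace.exp (t • ξ) * k)) 0

theorem contDiffOn_aux {A : Type*} [NormedRing A] [NormedAlgebra ℝ A] (ψ : A → ℂ) (W : Set A)
    (hW : IsOpen W) (hψ : ContDiffOn ℝ 2 ψ W) (ξ : A) :
    ContDiffOn ℝ 1 (fun k => fderiv ℝ ψ k (ξ * k)) W := by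
  have hf : ContDiffOn ℝ 1 (fderiv ℝ ψ) W := hψ.fderiv_of_isOpen hW (by norm_num)
  exact hf.clm_apply (contDiffOn_const.mul contDiffOn_id)

theorem exp_aux {A : Type*} [NormedRing A] [NormedAlgebra ℝ A] [CompleteSpace A] (ξ k : A) :
    HasDerivAt (fun t : ℝ => NormedSpace.exp (t • ξ) * k) (ξ * k) 0 := by
  have := (hasDerivAt_exp_smul_const (𝕂 := ℝ) ξ (0 : ℝ)).mul_const k
  simpa using this

theorem rightD_eq {D : ℕ} (ξ : Mat D) (φ : Mat D → ℂ) (k : Mat D)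
    (h : DifferentiableAt ℝ φ k) : rightD ξ φ k = fderiv ℝ φ k (ξ * k) := by
  unfold rightD
  have h1 : HasDerivAt (fun t : ℝ => NormedSpace.exp (t • ξ) * k) (ξ * k) 0 := exp_aux ξ k
  have h2 : HasFDerivAt φ (fderiv ℝ φ k) (NormedSpace.exp ((0 : ℝ) • ξ) * k) := by
    simpa using h.hasFDerivAt
  exact (h2.comp_hasDerivAt (0 : ℝ) h1).deriv

theorem rightD_ftc {D : ℕ} (βd : ℝ → Mat D) (hβd : ContinuousOn βd (Set.Icc 0 1))
    (G : ℝ → Mat D)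
    (hG : ∀ t ∈ Set.Icc (0 : ℝ) 1, HasDerivWithinAt G (-(βd t) * G t) (Set.Icc 0 1) t)
    (φ : Mat D → ℂ) (W : Set (Mat D)) (hW : IsOpen W) (hGW : ∀ t, G t ∈ W)
    (hφ : ContDiffOn ℝ 1 φ W) (τ : ℝ) (hτ : τ ∈ Set.Icc (0 : ℝ) 1) :
    IntervalIntegrable (fun s => rightD (βd s) φ (G s)) MeasureTheory.volume 0 τ ∧
    ∫ s in (0 : ℝ)..τ, rightD (βd s) φ (G s) = φ (G 0) - φ (G τ) := by
  have hd : ∀ k ∈ W, DifferentiableAt ℝ φ k := fun k hk =>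
    (hφ.differentiableOn one_ne_zero).differentiableAt (hW.mem_nhds hk)
  have hGc : ContinuousOn G (Set.Icc 0 1) := fun t ht => (hG t ht).continuousWithinAt
  have hfc : ContinuousOn (fderiv ℝ φ) W := hφ.continuousOn_fderiv_of_isOpen hW le_rfl
  have hsub : Set.Icc 0 τ ⊆ Set.Icc (0 : ℝ) 1 := Set.Icc_subset_Icc le_rfl hτ.2
  have hc : ContinuousOn (fun s => rightD (βd s) φ (G s)) (Set.Icc 0 1) := by
    have : ContinuousOn (fun s => fderiv ℝ φ (G s) (βd s * G s)) (Set.Icc 0 1) :=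
      (hfc.comp hGc (fun t _ => hGW t)).clm_apply (hβd.mul hGc)
    exact this.congr fun s _ => rightD_eq _ _ _ (hd _ (hGW s))
  have hi : IntervalIntegrable (fun s => rightD (βd s) φ (G s)) MeasureTheory.volume 0 τ := by
    apply ContinuousOn.intervalIntegrable
    rw [Set.uIcc_of_le hτ.1]
    exact hc.mono hsub
  refine ⟨hi, ?_⟩
  have hder : ∀ t ∈ Set.Icc (0 : ℝ) 1, HasDerivWithinAt (fun s => - φ (G s))
      (rightD (βd t) φ (G t)) (Set.Icc 0 1) t := by
    intro t ht
    have := ((hd _ (hGW t)).hasFDerivAt.comp_hasDerivWithinAt t (hG t ht)).neg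
    rw [rightD_eq _ _ _ (hd _ (hGW t))]
    have e : fderiv ℝ φ (G t) (βd t * G t) = -(fderiv ℝ φ (G t) (-(βd t) * G t)) := by
      rw [neg_mul, map_neg, neg_neg]
    rw [e]
    exact this
  have := intervalIntegral.integral_eq_sub_of_hasDerivAt_of_le hτ.1
    (f := fun s => - φ (G s)) (f' := fun s => rightD (βd s) φ (G s))
    (fun t ht => ((hder t (hsub ht)).continuousWithinAt).mono hsub)
    (fun t ht => (hder t (hsub ⟨ht.1.le, ht.2.le⟩)).hasDerivAt
      (Icc_mem_nhds ht.1 (ht.2.trans_le hτ.2))) hi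
  rw [this]; ring

theorem stmt5 {D : ℕ} (K : Subgroup (Mat D)ˣ) (𝔨 : Set (Mat D))
    (β βd : ℝ → Mat D) (hβ𝔨 : ∀ t, β t ∈ 𝔨) (hβ0 : β 0 = 0)
    (hβ : ∀ t ∈ Set.Icc (0 : ℝ) 1, HasDerivWithinAt β (βd t) (Set.Icc 0 1) t)
    (hβd : ContinuousOn βd (Set.Icc 0 1))
    (g : ℝ → K) (hg0 : g 0 = 1)
    (hg : ∀ t ∈ Set.Icc (0 : ℝ) 1, HasDerivWithinAt (fun t' => Kval K (g t'))
      (-(βd t) * Kval K (g t)) (Set.Icc 0 1) t)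
    (ψ : Mat D → ℂ) (W : Set (Mat D)) (hW : IsOpen W)
    (hKW : ∀ k : K, Kval K k ∈ W) (hψ : ContDiffOn ℝ 2 ψ W) :
    ψ (Kval K (g 1))
      = ψ 1 - rightD (β 1) ψ 1
        + ∫ τ in (0 : ℝ)..1, ∫ s in (0 : ℝ)..τ,
            rightD (βd s) (rightD (βd τ) ψ) (Kval K (g s)) := by
  have hGW : ∀ t, Kval K (g t) ∈ W := fun t => hKW _
  have hG0 : Kval K (g 0) = 1 := by simp [hg0, Kval]
  have h1W : (1 : Mat D) ∈ W := hG0 ▸ hGW 0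
  have hd : ∀ k ∈ W, DifferentiableAt ℝ ψ k := fun k hk =>
    (hψ.differentiableOn two_ne_zero).differentiableAt (hW.mem_nhds hk)
  obtain ⟨hi1, h1⟩ := rightD_ftc βd hβd (fun t => Kval K (g t)) hg ψ W hW hGW
    (hψ.of_le one_le_two) 1 ⟨zero_le_one, le_rfl⟩
  have hin : ∀ τ ∈ Set.Icc (0 : ℝ) 1,
      ∫ s in (0 : ℝ)..τ, rightD (βd s) (rightD (βd τ) ψ) (Kval K (g s))
        = fderiv ℝ ψ 1 (βd τ) - rightD (βd τ) ψ (Kval K (g τ)) := by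
    intro τ hτ
    have hC : ContDiffOn ℝ 1 (rightD (βd τ) ψ) W := by
      have : ContDiffOn ℝ 1 (fun k => fderiv ℝ ψ k (βd τ * k)) W :=
        contDiffOn_aux ψ W hW hψ (βd τ)
      exact this.congr fun k hk => rightD_eq _ _ _ (hd k hk)
    have := (rightD_ftc βd hβd (fun t => Kval K (g t)) hg _ W hW hGW hC τ hτ).2
    rw [this, hG0, rightD_eq _ _ 1 (hd 1 h1W), mul_one]
  have hder : ∀ t ∈ Set.Icc (0 : ℝ) 1, HasDerivWithinAt (fun s => fderiv ℝ ψ 1 (β s))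
      (fderiv ℝ ψ 1 (βd t)) (Set.Icc 0 1) t := fun t ht =>
    (fderiv ℝ ψ 1).hasFDerivAt.comp_hasDerivWithinAt t (hβ t ht)
  have hi2 : IntervalIntegrable (fun s => fderiv ℝ ψ 1 (βd s)) MeasureTheory.volume 0 1 := by
    apply ContinuousOn.intervalIntegrable
    rw [Set.uIcc_of_le zero_le_one]
    exact (fderiv ℝ ψ 1).continuous.comp_continuousOn hβd
  have h2 := intervalIntegral.integral_eq_sub_of_hasDerivAt_of_le (zero_le_one (α := ℝ))
    (f := fun s => fderiv ℝ ψ 1 (β s)) (f' := fun s => fderiv ℝ ψ 1 (βd s))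
    (fun t ht => (hder t ht).continuousWithinAt)
    (fun t ht => (hder t ⟨ht.1.le, ht.2.le⟩).hasDerivAt (Icc_mem_nhds ht.1 ht.2)) hi2
  rw [intervalIntegral.integral_congr (g := fun τ =>
    fderiv ℝ ψ 1 (βd τ) - rightD (βd τ) ψ (Kval K (g τ)))
    (fun τ hτ => hin τ (by rwa [Set.uIcc_of_le zero_le_one] at hτ)),
    intervalIntegral.integral_sub hi2 hi1, h1, h2, hG0, rightD_eq _ _ 1 (hd 1 h1W), hβ0]
  simp

end
end

section
/- Let f be a 𝔨-valued white noise, let g : ℝ² → K be continuous, let B ⊆ ℝ² be a bounded Borel set, and let (Π_n) be a sequence of finite Borel partitions of B such that osc_{Π_n}(g) := max_{A∈Π_n} sup_{p,q∈A} |g(q) − g(p)| → 0 as n → ∞; for each cell A choose a point p_A ∈ A. Define f(A) := Σ_{ξ∈β} f(1_A ξ) ξ ∈ L²(Ω,ℙ;𝔨) for any finite-area Borel set A (β an orthonormal basis of 𝔨), and define f^g(B) ∈ L²(Ω,ℙ;𝔨) by ⟨f^g(B), ξ⟩_𝔨 := f(1_B Ad_{g(·)} ξ) for all ξ ∈ 𝔨,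 where (Ad_g u)(x) := g(x) u(x) g(x)⁻¹. Then Σ_{A∈Π_n} Ad_{g(p_A)⁻¹} f(A) converges to f^g(B) in L²(Ω,ℙ;𝔨) as n → ∞. -/
/-!
Statement 6 (Lemma 4.3 of the paper: rotating white noise).

`f` is a `𝔨`-valued white noise on `ℝ²` (modeled by a linear map on `L²(ℝ²; 𝔨)` whose values
are mean zero Gaussians of variance `‖u‖²`); the Lie algebra `𝔨` (with its `Ad_K`-invariant
inner product) is modeled by a finite dimensional real inner product space `E` on which `K`
acts by linear isometries via `Ad`.  `g : ℝ² → K` is continuous, `B` is a bounded Borel set,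
`(Π_n)` is a sequence of finite Borel partitions of `B` with `osc_{Π_n}(g) → 0`, and
`p_A ∈ A` are chosen points.  `W A = f(A)` are the vector-valued white noise masses
(characterized by `⟨f(A), ξ⟩ = f(1_A ξ)`), and `Y = f^g(B)` is characterized by
`⟨f^g(B), ξ⟩ = f(1_B Ad_{g(·)} ξ)`.  Then
`∑_{A ∈ Π_n} Ad_{g(p_A)⁻¹} f(A) → f^g(B)` in `L²(Ω, ℙ; 𝔨)`.
-/

open Matrix MeasureTheory

attribute [local instance] Matrix.linftyOpNormedAddCommGroup Matrix.linftyOpNormedRing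
  Matrix.linftyOpNormedAlgebra

noncomputable section

/-- The second moment of a white noise value is the squared norm. -/
theorem wn_second_moment {Ω : Type*} [MeasurableSpace Ω] (ℙ : Measure Ω)
    (X : Lp ℝ 2 ℙ) (v : NNReal)
    (h : Measure.map X ℙ = ProbabilityTheory.gaussianReal 0 v) :
    ∫ ω, (X ω) ^ 2 ∂ℙ = v := by
  have hX : AEMeasurable X ℙ := (Lp.aestronglyMeasurable X).aemeasurable
  have h1 : ∫ ω, (X ω) ^ 2 ∂ℙ = ∫ x, x ^ 2 ∂(Measure.map X ℙ) :=
    (integral_map (f := fun x : ℝ => x ^ 2) hX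
      (by fun_prop)).symm
  rw [h1, h]
  have h2 := ProbabilityTheory.variance_id_gaussianReal (μ := 0) (v := v)
  rw [ProbabilityTheory.variance_eq_integral aemeasurable_id] at h2
  simpa using h2

/-- Coercion of a finite sum of `Lp` functions. -/
theorem wn_coeFn_sum {α F ι : Type*} [MeasurableSpace α] [NormedAddCommGroup F] (μ : Measure α)
    (s : Finset ι) (u : ι → Lp F 2 μ) :
    (fun x => ∑ i ∈ s, (u i : α → F) x) =ᵐ[μ] ((∑ i ∈ s, u i : Lp F 2 μ) : α → F) := by
  classical
  induction s using Finset.induction_on with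
  | empty =>
    simp only [Finset.sum_empty]
    filter_upwards [Lp.coeFn_zero F 2 μ] with x hx
    rw [hx]; rfl
  | insert a s ha ih =>
    rw [Finset.sum_insert ha]
    filter_upwards [ih, Lp.coeFn_add (u a) (∑ i ∈ s, u i)] with x hx hx2
    rw [hx2, Finset.sum_insert ha, hx]; rfl

theorem stmt6 {D : ℕ} (K : Subgroup (Mat D)ˣ)
    -- the Lie algebra `𝔨` with its `Ad_K`-invariant inner product, on which `K` acts by
    -- the (isometric) adjoint action
    (E : Type*) [NormedAddCommGroup E] [InnerProductSpace ℝ E] [FiniteDimensional ℝ E]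
    (Ad : K →* (E ≃ₗᵢ[ℝ] E))
    -- the white noise
    {Ω : Type*} [MeasurableSpace Ω] (ℙ : Measure Ω) [IsProbabilityMeasure ℙ]
    (f : Lp E 2 (volume : Measure (ℝ × ℝ)) →ₗ[ℝ] Lp ℝ 2 ℙ)
    (hGauss : ∀ u : Lp E 2 (volume : Measure (ℝ × ℝ)),
      Measure.map (f u) ℙ = ProbabilityTheory.gaussianReal 0 (‖u‖₊ ^ 2))
    -- the continuous gauge function `g : ℝ² → K`
    (g : ℝ × ℝ → K) (hg : ∀ v : E, Continuous fun x => Ad (g x) v)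
    -- the bounded Borel set `B`
    (B : Set (ℝ × ℝ)) (hB : MeasurableSet B) (hBbdd : Bornology.IsBounded B)
    -- the partitions `Π_n` of `B` and the points `p_A ∈ A`
    (P : ℕ → Finset (Set (ℝ × ℝ)))
    (hPmeas : ∀ n, ∀ A ∈ P n, MeasurableSet A)
    (hPdisj : ∀ n, (↑(P n) : Set (Set (ℝ × ℝ))).PairwiseDisjoint id)
    (hPcover : ∀ n, ⋃₀ (↑(P n) : Set (Set (ℝ × ℝ))) = B)
    (p : Set (ℝ × ℝ) → ℝ × ℝ) (hp : ∀ n, ∀ A ∈ P n, p A ∈ A)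
    -- `osc_{Π_n}(g) → 0`
    (hosc : ∀ ε > (0 : ℝ), ∃ N : ℕ, ∀ n ≥ N, ∀ A ∈ P n, ∀ x ∈ A, ∀ z ∈ A,
      ∀ v : E, ‖Ad (g x) v - Ad (g z) v‖ ≤ ε * ‖v‖)
    -- `W A` is (a version of) the `E`-valued random variable `f(A)`, characterized by
    -- `⟨f(A), ξ⟩ = f(1_A ξ)` for all `ξ ∈ 𝔨`
    (W : Set (ℝ × ℝ) → Ω → E)
    (hW : ∀ (A : Set (ℝ × ℝ)) (hA : MeasurableSet A) (hAfin : volume A ≠ ⊤) (ξ : E),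
      (fun ω => (inner ℝ (W A ω) ξ : ℝ))
        =ᵐ[ℙ] (f ((memLp_indicator_const 2 hA ξ (Or.inr hAfin)).toLp _) : Ω → ℝ))
    -- `Y` is (a version of) `f^g(B)`, characterized by `⟨f^g(B), ξ⟩ = f(1_B Ad_{g(·)} ξ)`
    (hmemB : ∀ ξ : E, MemLp (B.indicator fun x => Ad (g x) ξ) 2 (volume : Measure (ℝ × ℝ)))
    (Y : Ω → E)
    (hY : ∀ ξ : E,
      (fun ω => (inner ℝ (Y ω) ξ : ℝ)) =ᵐ[ℙ] (f ((hmemB ξ).toLp _) : Ω → ℝ)) :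
    -- conclusion : `∑_{A ∈ Π_n} Ad_{g(p_A)⁻¹} f(A) → f^g(B)` in `L²(Ω, ℙ; E)`
    Filter.Tendsto
      (fun n => ∫ ω, ‖(∑ A ∈ P n, Ad ((g (p A))⁻¹) (W A ω)) - Y ω‖ ^ 2 ∂ℙ)
      Filter.atTop (nhds 0) := by
  classical
  have hBfin : volume B ≠ ⊤ := hBbdd.measure_lt_top.ne
  have hsub : ∀ n, ∀ A ∈ P n, A ⊆ B := fun n A hA => by
    rw [← hPcover n]; exact Set.subset_sUnion_of_mem hA
  have hfin : ∀ n, ∀ A ∈ P n, volume A ≠ ⊤ := fun n A hA =>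
    ((measure_mono (hsub n A hA)).trans_lt hBfin.lt_top).ne
  -- the approximating test function
  let U : ∀ n : ℕ, E → {A // A ∈ P n} → Lp E 2 (volume : Measure (ℝ × ℝ)) := fun n ξ A =>
    (memLp_indicator_const 2 (hPmeas n A A.2) (Ad (g (p A)) ξ) (Or.inr (hfin n A A.2))).toLp _
  let h : ℕ → E → Lp E 2 (volume : Measure (ℝ × ℝ)) := fun n ξ =>
    ∑ A ∈ (P n).attach, U n ξ A - (hmemB ξ).toLp _
  let Z : ℕ → Ω → E := fun n ω => (∑ A ∈ P n, Ad ((g (p A))⁻¹) (W A ω)) - Y ω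
  have hZ : ∀ n ξ, (fun ω => (inner ℝ (Z n ω) ξ : ℝ)) =ᵐ[ℙ] (f (h n ξ) : Ω → ℝ) := by
    intro n ξ
    have e1 : ∀ᵐ ω ∂ℙ, ∀ A : {A // A ∈ P n},
        (inner ℝ (W A ω) (Ad (g (p A)) ξ) : ℝ) = f (U n ξ A) ω := by
      rw [ae_all_iff]
      intro A
      exact hW A (hPmeas n A A.2) (hfin n A A.2) _
    have e2 : f (h n ξ) = ∑ A ∈ (P n).attach, f (U n ξ A) - f ((hmemB ξ).toLp _) := by
      simp only [h, map_sub, map_sum]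
    rw [e2]
    filter_upwards [e1, hY ξ, wn_coeFn_sum ℙ (P n).attach (fun A => f (U n ξ A)),
      Lp.coeFn_sub (∑ A ∈ (P n).attach, f (U n ξ A)) (f ((hmemB ξ).toLp _))] with ω h1 h2 h3 h4
    rw [h4, Pi.sub_apply, ← h3, ← h2]
    simp only [Z, inner_sub_left, sum_inner]
    congr 1
    rw [← Finset.sum_attach]
    refine Finset.sum_congr rfl fun A _ => ?_
    have h5 : Ad (g (p A)) (Ad ((g (p A))⁻¹) (W A ω)) = W A ω := by
      change (Ad (g (p A)) * Ad ((g (p A))⁻¹)) (W A ω) = W A ω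
      rw [← map_mul, mul_inv_cancel, map_one]
      rfl
    rw [← h1 A, ← LinearIsometryEquiv.inner_map_map (Ad (g (p A))), h5]
  have hbound : ∀ ε > (0 : ℝ), ∃ N : ℕ, ∀ n ≥ N, ∀ ξ : E,
      ‖h n ξ‖ ≤ ε * ‖ξ‖ * (volume.real B) ^ (1 / (2 : ENNReal).toReal) := by
    intro ε hε
    obtain ⟨N, hN⟩ := hosc ε hε
    refine ⟨N, fun n hn ξ => ?_⟩
    have key : ‖h n ξ‖ ≤ ‖indicatorConstLp 2 hB hBfin (ε * ‖ξ‖ : ℝ)‖ := by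
      apply Lp.norm_le_norm_of_ae_le
      have e1 : ∀ᵐ x ∂(volume : Measure (ℝ × ℝ)), ∀ A : {A // A ∈ P n},
          U n ξ A x = (A : Set (ℝ × ℝ)).indicator (fun _ => Ad (g (p A)) ξ) x := by
        rw [ae_all_iff]
        intro A
        exact MemLp.coeFn_toLp _
      filter_upwards [e1, MemLp.coeFn_toLp (hmemB ξ), wn_coeFn_sum volume (P n).attach (U n ξ),
        Lp.coeFn_sub (∑ A ∈ (P n).attach, U n ξ A) ((hmemB ξ).toLp _),
        indicatorConstLp_coeFn (p := 2) (hs := hB) (hμs := hBfin) (c := (ε * ‖ξ‖ : ℝ))]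
        with x h1 h2 h3 h4 h5
      rw [h5]
      simp only [h]
      rw [h4, Pi.sub_apply, ← h3, h2, Finset.sum_congr rfl fun A _ => h1 A]
      by_cases hx : x ∈ B
      · have hx' := hx
        rw [← hPcover n] at hx'
        obtain ⟨A, hA, hxA⟩ := hx'
        rw [Finset.sum_eq_single (⟨A, hA⟩ : {A // A ∈ P n})]
        · rw [Set.indicator_of_mem hx, Set.indicator_of_mem hx, Set.indicator_of_mem hxA]
          refine (hN n hn A hA _ (hp n A hA) x hxA ξ).trans (le_abs_self _)
        · intro A' _ hne
          refine Set.indicator_of_notMem (fun hxA' => ?_) _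
          have hd := hPdisj n A'.2 hA (fun h => hne (Subtype.ext h))
          exact Set.disjoint_left.1 hd hxA' hxA
        · intro hh
          exact absurd (Finset.mem_attach _ _) hh
      · rw [Finset.sum_eq_zero]
        · simp [hx]
        · intro A _
          exact Set.indicator_of_notMem (fun hxA => hx (hsub n A A.2 hxA)) _
    refine key.trans (le_of_eq ?_)
    rw [norm_indicatorConstLp (by norm_num) (by norm_num), Real.norm_of_nonneg (by positivity)]
  have hlim : ∀ ξ, Filter.Tendsto (fun n => ‖h n ξ‖) Filter.atTop (nhds 0) := by
    intro ξ
    rw [Metric.tendsto_atTop]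
    intro ε hε
    set C : ℝ := ‖ξ‖ * (volume.real B) ^ (1 / (2 : ENNReal).toReal) with hC
    have hC0 : 0 ≤ C := by positivity
    obtain ⟨N, hN⟩ := hbound (ε / (C + 1)) (by positivity)
    refine ⟨N, fun n hn => ?_⟩
    have := hN n hn ξ
    rw [mul_assoc, ← hC] at this
    rw [dist_zero_right, norm_norm]
    refine this.trans_lt ?_
    rw [div_mul_eq_mul_div, div_lt_iff₀ (by positivity)]
    nlinarith
  let b := stdOrthonormalBasis ℝ E
  have hint : ∀ n, ∫ ω, ‖Z n ω‖ ^ 2 ∂ℙ = ∑ i, ‖h n (b i)‖ ^ 2 := by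
    intro n
    have e0 : ∀ ω, ‖Z n ω‖ ^ 2 = ∑ i, (inner ℝ (Z n ω) (b i) : ℝ) ^ 2 := fun ω => by
      rw [← b.sum_sq_norm_inner_left (Z n ω)]
      simp
    have e3 : (fun ω => ‖Z n ω‖ ^ 2) =ᵐ[ℙ] fun ω => ∑ i, (f (h n (b i)) ω) ^ 2 := by
      have : ∀ᵐ ω ∂ℙ, ∀ i, (inner ℝ (Z n ω) (b i) : ℝ) = f (h n (b i)) ω := by
        rw [ae_all_iff]
        exact fun i => hZ n (b i)
      filter_upwards [this] with ω hω
      rw [e0, Finset.sum_congr rfl fun i _ => by rw [hω i]]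
    rw [integral_congr_ae e3, integral_finsetSum]
    · refine Finset.sum_congr rfl fun i _ => ?_
      rw [wn_second_moment ℙ _ _ (hGauss _)]
      simp
    · intro i _
      exact (Lp.memLp (f (h n (b i)))).integrable_sq
  change Filter.Tendsto (fun n => ∫ ω, ‖Z n ω‖ ^ 2 ∂ℙ) Filter.atTop (nhds 0)
  simp only [hint]
  have := tendsto_finsetSum (Finset.univ) (fun i _ => (hlim (b i)).pow 2)
  simpa using this

end
end
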